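/- Let m and n be positive integers and let z be a complex number such that z^j ≠ 1 for every 1 ≤ j ≤ n. Then Σ_{k=1}^n z^k k^m = z(1−z^n)/(1−z) + Σ_{j=2}^n J_m(j) · z^j (1 − z^{j⌊n/j⌋})/(1−z^j). -/

import Mathlib

/-- The Jordan totient `J_m(k) = k^m ∏_{p prime, p ∣ k} (1 − p^{−m})`. -/
def jordanTotient (m k : ℕ) : ℚ :=
  (k : ℚ) ^ m * ∏ p ∈ k.primeFactors, (1 - ((p : ℚ) ^ m)⁻¹)

open ArithmeticFunction in
/-- The Jordan totient sums over the divisors of `k` to `k ^ m`. -/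
theorem sum_divisors_jordanTotient (m : ℕ) {k : ℕ} (hk : k ≠ 0) :
    ∑ d ∈ k.divisors, jordanTotient m d = (k : ℚ) ^ m := by
  let J : ArithmeticFunction ℚ :=
    (ArithmeticFunction.pow m : ArithmeticFunction ℚ).pmul
      (prodPrimeFactors fun p ↦ 1 - ((p : ℚ) ^ m)⁻¹)
  have hJ (d : ℕ) (hd : d ≠ 0) : J d = jordanTotient m d := by
    simp [J, jordanTotient, pow_apply, prodPrimeFactors_apply, hd]
  have hmul : J.IsMultiplicative :=
    isMultiplicative_pow.natCast.pmul (IsMultiplicative.prodPrimeFactors _)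
  have key : J * (zeta : ArithmeticFunction ℚ) =
      (ArithmeticFunction.pow m : ArithmeticFunction ℚ) := by
    rw [(hmul.mul isMultiplicative_zeta.natCast).eq_iff_eq_on_prime_powers _ _
      isMultiplicative_pow.natCast]
    intro p i hp
    rw [coe_mul_zeta_apply, Nat.sum_divisors_prime_pow hp]
    induction i with
    | zero => simp [hJ, jordanTotient, pow_apply]
    | succ i ih =>
      have hp0 : (p : ℚ) ≠ 0 := by exact_mod_cast hp.ne_zero
      rw [Finset.sum_range_succ, ih, hJ _ (pow_ne_zero _ hp.ne_zero), jordanTotient,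
        Nat.primeFactors_prime_pow i.succ_ne_zero hp]
      simp only [natCoe_apply, pow_apply, pow_ne_zero _ hp.ne_zero, and_false, if_false,
        Finset.prod_singleton]
      push_cast
      field_simp
      ring
  have h := DFunLike.congr_fun key k
  rw [coe_mul_zeta_apply] at h
  rw [← Finset.sum_congr rfl fun d hd ↦ hJ d (Nat.pos_of_mem_divisors hd).ne', h]
  simp [pow_apply, hk]

/-- Summing over `k ≤ n` and `d ∣ k` amounts to summing over `j ≤ n` and the multiples
`j * q ≤ n`. -/
theorem sum_Icc_sum_divisors_eq_sum_sum_multiples {M : Type*} [AddCommMonoid M] (n : ℕ)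
    (f : ℕ → ℕ → M) :
    ∑ k ∈ Finset.Icc 1 n, ∑ d ∈ k.divisors, f d k =
      ∑ j ∈ Finset.Icc 1 n, ∑ q ∈ Finset.Icc 1 (n / j), f j (j * q) := by
  rw [Finset.sum_sigma', Finset.sum_sigma']
  refine Finset.sum_bij' (fun x _ ↦ ⟨x.2, x.1 / x.2⟩) (fun x _ ↦ ⟨x.1 * x.2, x.1⟩) ?_ ?_ ?_ ?_ ?_
  · rintro ⟨k, d⟩ h
    simp only [Finset.mem_sigma, Finset.mem_Icc, Nat.mem_divisors] at h ⊢
    obtain ⟨⟨hk, hkn⟩, hdk, -⟩ := h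
    exact ⟨⟨Nat.pos_of_dvd_of_pos hdk hk, (Nat.le_of_dvd hk hdk).trans hkn⟩,
      Nat.div_pos (Nat.le_of_dvd hk hdk) (Nat.pos_of_dvd_of_pos hdk hk),
      Nat.div_le_div_right hkn⟩
  · rintro ⟨j, q⟩ h
    simp only [Finset.mem_sigma, Finset.mem_Icc, Nat.mem_divisors] at h ⊢
    obtain ⟨⟨hj, hjn⟩, hq, hqn⟩ := h
    have hjq : 0 < j * q := Nat.mul_pos hj hq
    exact ⟨⟨hjq, (Nat.mul_le_mul_left j hqn).trans (Nat.mul_div_le n j)⟩,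
      dvd_mul_right j q, hjq.ne'⟩
  · rintro ⟨k, d⟩ h
    simp only [Finset.mem_sigma, Nat.mem_divisors] at h
    simp [Nat.mul_div_cancel' h.2.1]
  · rintro ⟨j, q⟩ h
    simp only [Finset.mem_sigma, Finset.mem_Icc] at h
    simp [Nat.mul_div_cancel_left q h.1.1]
  · rintro ⟨k, d⟩ h
    simp only [Finset.mem_sigma, Nat.mem_divisors] at h
    simp [Nat.mul_div_cancel' h.2.1]

/-- The geometric sum `w + w ^ 2 + ⋯ + w ^ N`. -/
theorem geom_sum_Icc_one {K : Type*} [Field K] {w : K} (hw : w ≠ 1) (N : ℕ) :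
    ∑ q ∈ Finset.Icc 1 N, w ^ q = w * (1 - w ^ N) / (1 - w) := by
  rw [← Finset.Ico_add_one_right_eq_Icc, geom_sum_Ico' hw (Nat.le_add_left 1 N)]
  ring

/-- For positive integers `m`, `n` and complex `z` with `z^j ≠ 1` for `1 ≤ j ≤ n`:
`Σ_{k=1}^n z^k k^m = z(1−z^n)/(1−z) + Σ_{j=2}^n J_m(j) z^j(1−z^{j⌊n/j⌋})/(1−z^j)`. -/
theorem sum_pow_mul_geom_eq_sum_jordan (m n : ℕ) (hm : 0 < m) (hn : 0 < n)
    (z : ℂ) (hz : ∀ j ∈ Finset.Icc 1 n, z ^ j ≠ 1) :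
    ∑ k ∈ Finset.Icc 1 n, z ^ k * (k : ℂ) ^ m =
      z * (1 - z ^ n) / (1 - z) +
        ∑ j ∈ Finset.Icc 2 n,
          (jordanTotient m j : ℂ) * (z ^ j * (1 - z ^ (j * (n / j))) / (1 - z ^ j)) := by
  have expand (k : ℕ) (hk : k ∈ Finset.Icc 1 n) : z ^ k * (k : ℂ) ^ m =
      ∑ d ∈ k.divisors, (jordanTotient m d : ℂ) * z ^ k := by
    have h := sum_divisors_jordanTotient m (Nat.one_le_iff_ne_zero.1 (Finset.mem_Icc.1 hk).1)
    rw [← Finset.sum_mul, mul_comm]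
    exact_mod_cast congrArg (fun x : ℚ ↦ (x : ℂ) * z ^ k) h.symm
  have inner (j : ℕ) (hj : j ∈ Finset.Icc 1 n) :
      ∑ q ∈ Finset.Icc 1 (n / j), (jordanTotient m j : ℂ) * z ^ (j * q) =
        (jordanTotient m j : ℂ) * (z ^ j * (1 - z ^ (j * (n / j))) / (1 - z ^ j)) := by
    simp_rw [← Finset.mul_sum, pow_mul]
    rw [geom_sum_Icc_one (hz j hj)]
  rw [Finset.sum_congr rfl expand, sum_Icc_sum_divisors_eq_sum_sum_multiples n
    fun d k ↦ (jordanTotient m d : ℂ) * z ^ k, Finset.sum_congr rfl inner,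
    ← Finset.add_sum_Ioc_eq_sum_Icc hn]
  congr 1
  simp [jordanTotient]
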